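/- arXiv:1408.6693 — 3 statements merged into one kernel-verified Lean document; each statement's English description precedes it below -/
import Mathlib

section
/- Suppose h(w) ≠ 0 for every w ∈ S. Then for every v ∈ S the following are equivalent: (i) f(v) = v or f(v) = −v; (ii) φ(v) = 0. Moreover, if these hold, then h(v) = α(v)·v with α(v) ≠ 0, and f(v) = sign(α(v))·v. -/
open MeasureTheory
open scoped RealInnerProductSpace

noncomputable section

/-- `E[g(wᵀx)·x]`. -/
def mvec {d : ℕ} {Ω : Type*} [MeasurableSpace Ω] (μ : Measure Ω)
    (x : Ω → EuclideanSpace ℝ (Fin d)) (g : ℝ → ℝ)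
    (w : EuclideanSpace ℝ (Fin d)) : EuclideanSpace ℝ (Fin d) :=
  ∫ ω, g ⟪w, x ω⟫ • x ω ∂μ

/-- `h(w) = E[g'(wᵀx)]·w − E[g(wᵀx)·x]`. -/
def hfun {d : ℕ} {Ω : Type*} [MeasurableSpace Ω] (μ : Measure Ω)
    (x : Ω → EuclideanSpace ℝ (Fin d)) (g g' : ℝ → ℝ)
    (w : EuclideanSpace ℝ (Fin d)) : EuclideanSpace ℝ (Fin d) :=
  (∫ ω, g' ⟪w, x ω⟫ ∂μ) • w - mvec μ x g w

/-- `α(w) = E[g'(wᵀx)] − E[g(wᵀx)·(wᵀx)]`. -/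
def alphafun {d : ℕ} {Ω : Type*} [MeasurableSpace Ω] (μ : Measure Ω)
    (x : Ω → EuclideanSpace ℝ (Fin d)) (g g' : ℝ → ℝ)
    (w : EuclideanSpace ℝ (Fin d)) : ℝ :=
  (∫ ω, g' ⟪w, x ω⟫ ∂μ) - ∫ ω, g ⟪w, x ω⟫ * ⟪w, x ω⟫ ∂μ

/-- `φ(w) = (I − wwᵀ)·E[g(wᵀx)·x]`. -/
def phifun {d : ℕ} {Ω : Type*} [MeasurableSpace Ω] (μ : Measure Ω)
    (x : Ω → EuclideanSpace ℝ (Fin d)) (g : ℝ → ℝ)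
    (w : EuclideanSpace ℝ (Fin d)) : EuclideanSpace ℝ (Fin d) :=
  mvec μ x g w - ⟪w, mvec μ x g w⟫ • w

/-- FastICA map `f(w) = h(w)/‖h(w)‖`. -/
def ffun {d : ℕ} {Ω : Type*} [MeasurableSpace Ω] (μ : Measure Ω)
    (x : Ω → EuclideanSpace ℝ (Fin d)) (g g' : ℝ → ℝ)
    (w : EuclideanSpace ℝ (Fin d)) : EuclideanSpace ℝ (Fin d) :=
  ‖hfun μ x g g' w‖⁻¹ • hfun μ x g g' w

lemma inner_mvec {d : ℕ} {Ω : Type*} [MeasurableSpace Ω] {μ : Measure Ω}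
    {x : Ω → EuclideanSpace ℝ (Fin d)} {g : ℝ → ℝ} {w : EuclideanSpace ℝ (Fin d)}
    (hint : Integrable (fun ω => g ⟪w, x ω⟫ • x ω) μ) :
    ⟪w, mvec μ x g w⟫ = ∫ ω, g ⟪w, x ω⟫ * ⟪w, x ω⟫ ∂μ := by
  simp only [mvec, ← integral_inner hint, real_inner_smul_right]

lemma hfun_eq_alphafun_smul_sub_phifun {d : ℕ} {Ω : Type*} [MeasurableSpace Ω] {μ : Measure Ω}
    {x : Ω → EuclideanSpace ℝ (Fin d)} {g : ℝ → ℝ} (g' : ℝ → ℝ) {w : EuclideanSpace ℝ (Fin d)}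
    (hint : Integrable (fun ω => g ⟪w, x ω⟫ • x ω) μ) :
    hfun μ x g g' w = alphafun μ x g g' w • w - phifun μ x g w := by
  rw [hfun, alphafun, phifun, inner_mvec hint]
  module

lemma inner_phifun {d : ℕ} {Ω : Type*} [MeasurableSpace Ω] (μ : Measure Ω)
    (x : Ω → EuclideanSpace ℝ (Fin d)) (g : ℝ → ℝ) {w : EuclideanSpace ℝ (Fin d)}
    (hw : ‖w‖ = 1) : ⟪w, phifun μ x g w⟫ = 0 := by
  simp [phifun, inner_sub_right, real_inner_smul_right, hw]

lemma phifun_eq_zero_of_hfun_eq_smul {d : ℕ} {Ω : Type*} [MeasurableSpace Ω] {μ : Measure Ω}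
    {x : Ω → EuclideanSpace ℝ (Fin d)} {g g' : ℝ → ℝ} {w : EuclideanSpace ℝ (Fin d)}
    (hint : Integrable (fun ω => g ⟪w, x ω⟫ • x ω) μ) (hw : ‖w‖ = 1) {c : ℝ}
    (hc : hfun μ x g g' w = c • w) : phifun μ x g w = 0 := by
  have hphi : phifun μ x g w = (alphafun μ x g g' w - c) • w := by
    rw [sub_smul, ← hc, hfun_eq_alphafun_smul_sub_phifun g' hint, sub_sub_cancel]
  have horth := inner_phifun μ x g hw
  rw [hphi, real_inner_smul_right, real_inner_self_eq_norm_sq, hw, one_pow, mul_one] at horth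
  rw [hphi, horth, zero_smul]

lemma inv_norm_smul_smul_eq_sign_smul {E : Type*} [NormedAddCommGroup E] [NormedSpace ℝ E]
    (a : ℝ) {v : E} (hv : ‖v‖ = 1) : ‖a • v‖⁻¹ • a • v = Real.sign a • v := by
  rw [norm_smul, hv, mul_one, smul_smul, Real.norm_eq_abs]
  congr 1
  rcases lt_trichotomy a 0 with ha | rfl | ha
  · rw [abs_of_neg ha, Real.sign_of_neg ha, inv_neg, neg_mul, inv_mul_cancel₀ ha.ne]
  · simp
  · rw [abs_of_pos ha, Real.sign_of_pos ha, inv_mul_cancel₀ ha.ne']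

/-- under assumption `h(w) ≠ 0` on the unit sphere, a unit vector `v` satisfies
`f(v) = ±v` iff `φ(v) = 0`, in which case `h(v) = α(v)·v`, `α(v) ≠ 0`,
and `f(v) = sign(α(v))·v`. -/
theorem stmt0 {d : ℕ} {Ω : Type*} [MeasurableSpace Ω] (μ : Measure Ω) [IsProbabilityMeasure μ]
    (x : Ω → EuclideanSpace ℝ (Fin d)) (g g' : ℝ → ℝ)
    (hg : ∀ t : ℝ, HasDerivAt g (g' t) t)
    (hInt1 : ∀ w : EuclideanSpace ℝ (Fin d), Integrable (fun ω => g' ⟪w, x ω⟫) μ)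
    (hInt2 : ∀ w : EuclideanSpace ℝ (Fin d), Integrable (fun ω => g ⟪w, x ω⟫ • x ω) μ)
    (hInt3 : ∀ w : EuclideanSpace ℝ (Fin d), Integrable (fun ω => g ⟪w, x ω⟫ * ⟪w, x ω⟫) μ)
    (hne : ∀ w : EuclideanSpace ℝ (Fin d), ‖w‖ = 1 → hfun μ x g g' w ≠ 0)
    (v : EuclideanSpace ℝ (Fin d)) (hv : ‖v‖ = 1) :
    ((ffun μ x g g' v = v ∨ ffun μ x g g' v = -v) ↔ phifun μ x g v = 0) ∧
    (phifun μ x g v = 0 →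
      hfun μ x g g' v = alphafun μ x g g' v • v ∧
      alphafun μ x g g' v ≠ 0 ∧
      ffun μ x g g' v = Real.sign (alphafun μ x g g' v) • v) := by
  have fixed (hphi : phifun μ x g v = 0) :
      hfun μ x g g' v = alphafun μ x g g' v • v ∧
      alphafun μ x g g' v ≠ 0 ∧
      ffun μ x g g' v = Real.sign (alphafun μ x g g' v) • v := by
    have hh : hfun μ x g g' v = alphafun μ x g g' v • v := by
      rw [hfun_eq_alphafun_smul_sub_phifun g' (hInt2 v), hphi, sub_zero]
    refine ⟨hh, fun h0 => hne v hv (by rw [hh, h0, zero_smul]), ?_⟩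
    rw [ffun, hh, inv_norm_smul_smul_eq_sign_smul _ hv]
  refine ⟨⟨fun hf => ?_, fun hphi => ?_⟩, fixed⟩
  · have hnorm : ‖hfun μ x g g' v‖ ≠ 0 := norm_ne_zero_iff.mpr (hne v hv)
    have hh : hfun μ x g g' v = ‖hfun μ x g g' v‖ • ffun μ x g g' v := by
      rw [ffun, smul_inv_smul₀ hnorm]
    rcases hf with hf | hf <;> rw [hf] at hh
    · exact phifun_eq_zero_of_hfun_eq_smul (hInt2 v) hv hh
    · exact phifun_eq_zero_of_hfun_eq_smul (hInt2 v) hv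
        (c := -‖hfun μ x g g' v‖) (hh.trans (by rw [smul_neg, neg_smul]))
  · obtain ⟨-, ha, hf⟩ := fixed hphi
    rcases Real.sign_apply_eq_of_ne_zero _ ha with hs | hs <;> rw [hf, hs]
    · exact Or.inr (neg_one_smul ℝ v)
    · exact Or.inl (one_smul ℝ v)
end
end

section
/- Fix v ∈ S. Assume J is three times continuously differentiable on a neighborhood of v, with gradient ∇J(v) = E[g(vᵀx)·x] and Hessian ∇²J(v) = E[g'(vᵀx)·x xᵀ]. Then there exist constants C > 0 and r > 0 such that for every w ∈ S with ‖w − v‖ ≤ r: |J(w) − J(v) − (w − v)ᵀφ(v) − ½ (w − v)ᵀ K(v) (w − v)| ≤ C·‖w − v‖³. -/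
open MeasureTheory Matrix
open scoped RealInnerProductSpace

noncomputable section

/-- `L(v) = (I − vvᵀ)·E[g'(vᵀx)(x xᵀ − I)]·(I − vvᵀ)`. -/
def Lmat {d : ℕ} {Ω : Type*} [MeasurableSpace Ω] (μ : Measure Ω)
    (x : Ω → EuclideanSpace ℝ (Fin d)) (g' : ℝ → ℝ)
    (v : EuclideanSpace ℝ (Fin d)) : Matrix (Fin d) (Fin d) ℝ :=
  (1 - Matrix.vecMulVec v v) *
    Matrix.of (fun i j => ∫ ω, g' ⟪v, x ω⟫ * (x ω i * x ω j - (if i = j then (1 : ℝ) else 0)) ∂μ)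
      * (1 - Matrix.vecMulVec v v)

/-- `K(v) = α(v)·I + L(v)`. -/
def Kmat {d : ℕ} {Ω : Type*} [MeasurableSpace Ω] (μ : Measure Ω)
    (x : Ω → EuclideanSpace ℝ (Fin d)) (g g' : ℝ → ℝ)
    (v : EuclideanSpace ℝ (Fin d)) : Matrix (Fin d) (Fin d) ℝ :=
  alphafun μ x g g' v • (1 : Matrix (Fin d) (Fin d) ℝ) + Lmat μ x g' v

/-- Integrating a power bound on the derivative along segments from the centre raises the exponent by one. -/
lemma norm_sub_le_mul_pow_succ_of_hasFDerivAt {E F : Type*} [NormedAddCommGroup E]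
    [NormedSpace ℝ E] [NormedAddCommGroup F] [NormedSpace ℝ F] {f : E → F} {f' : E → E →L[ℝ] F}
    {v : E} {r C : ℝ} (hC : 0 ≤ C) {n : ℕ}
    (hf : ∀ y ∈ Metric.ball v r, HasFDerivAt f (f' y) y)
    (hbound : ∀ y ∈ Metric.ball v r, ‖f' y‖ ≤ C * ‖y - v‖ ^ n) :
    ∀ y ∈ Metric.ball v r, ‖f y - f v‖ ≤ C * ‖y - v‖ ^ (n + 1) := by
  intro y hy
  have hr : 0 < r := (dist_nonneg).trans_lt hy
  have hseg : segment ℝ v y ⊆ Metric.ball v r :=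
    (convex_ball v r).segment_subset (Metric.mem_ball_self hr) hy
  have := (convex_segment v y).norm_image_sub_le_of_norm_hasFDerivWithin_le
    (f := f) (f' := f') (C := C * ‖y - v‖ ^ n)
    (fun z hz => (hf z (hseg hz)).hasFDerivWithinAt)
    (fun z hz => (hbound z (hseg hz)).trans (by
      gcongr
      exact norm_sub_le_of_mem_segment hz))
    (left_mem_segment ℝ v y) (right_mem_segment ℝ v y)
  rwa [mul_assoc, ← pow_succ] at this

/-- Second-order Taylor expansion with cubic remainder for a `C³` function. -/
lemma ContDiffAt.exists_abs_taylor_two_le {E : Type*} [NormedAddCommGroup E] [NormedSpace ℝ E]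
    {f : E → ℝ} {v : E} (hf : ContDiffAt ℝ 3 f v) :
    ∃ C ≥ (0 : ℝ), ∃ r > (0 : ℝ), ∀ y ∈ Metric.ball v r,
      |f y - f v - fderiv ℝ f v (y - v) - (1 / 2) * fderiv ℝ (fderiv ℝ f) v (y - v) (y - v)|
        ≤ C * ‖y - v‖ ^ 3 := by
  have hf1 : ContDiffAt ℝ 2 (fderiv ℝ f) v := hf.fderiv_right (by norm_num)
  have hf2 : ContDiffAt ℝ 1 (fderiv ℝ (fderiv ℝ f)) v := hf1.fderiv_right (by norm_num)
  have hsymm : IsSymmSndFDerivAt ℝ f v := hf.isSymmSndFDerivAt (by simp; norm_num)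
  obtain ⟨K, t, ht, hlip⟩ := hf2.exists_lipschitzOnWith
  have hd0 : ∀ᶠ y in nhds v, DifferentiableAt ℝ f y :=
    (hf.eventually (by simp)).mono fun y hy => hy.differentiableAt (by norm_num)
  have hd1 : ∀ᶠ y in nhds v, DifferentiableAt ℝ (fderiv ℝ f) y :=
    (hf1.eventually (by simp)).mono fun y hy => hy.differentiableAt (by norm_num)
  obtain ⟨r, hr, hball⟩ := Metric.eventually_nhds_iff_ball.1
    ((hd0.and hd1).and (Filter.eventually_mem_set.2 ht))
  refine ⟨K, K.2, r, hr, ?_⟩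
  set A := fderiv ℝ f v
  set B := fderiv ℝ (fderiv ℝ f) v with hB
  have h1 : ∀ y ∈ Metric.ball v r, ‖fderiv ℝ f y - A - B (y - v)‖ ≤ K * ‖y - v‖ ^ (1 + 1) := by
    have := norm_sub_le_mul_pow_succ_of_hasFDerivAt (f := fun y => fderiv ℝ f y - A - B (y - v))
      (f' := fun y => fderiv ℝ (fderiv ℝ f) y - B) (v := v) (r := r) K.2 (n := 1)
      (fun y hy => ((hball y hy).1.2.hasFDerivAt.sub_const A).sub
        (B.hasFDerivAt.comp y ((hasFDerivAt_id y).sub_const v)))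
      (fun y hy => by
        rw [pow_one, hB]
        exact hlip.norm_sub_le (hball y hy).2 (mem_of_mem_nhds ht))
    intro y hy
    simpa [A] using this y hy
  have h2 := norm_sub_le_mul_pow_succ_of_hasFDerivAt
      (f := fun y => f y - f v - A (y - v) - (1 / 2) * B (y - v) (y - v))
      (f' := fun y => fderiv ℝ f y - A - B (y - v)) (v := v) (r := r) K.2 (n := 1 + 1)
      (fun y hy => by
        have hs : HasFDerivAt (fun y => y - v) (ContinuousLinearMap.id ℝ E) y :=
          (hasFDerivAt_id y).sub_const v
        have hq := ((B.hasFDerivAt.comp y hs).clm_apply hs).const_mul (1 / 2 : ℝ)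
        refine ((((hball y hy).1.1.hasFDerivAt.sub_const (f v)).sub
          (A.hasFDerivAt.comp y hs)).sub hq).congr_fderiv ?_
        ext u
        have := hsymm (y - v) u
        simp [← hB] at this ⊢
        rw [this]
        ring)
      h1
  intro y hy
  simpa [Real.norm_eq_abs] using h2 y hy

/-- The quadratic form of a matrix of the shape `Bᵢⱼ - m δᵢⱼ`. -/
lemma dotProduct_mulVec_of_bilin_sub_smul {d : ℕ}
    (B : EuclideanSpace ℝ (Fin d) →L[ℝ] EuclideanSpace ℝ (Fin d) →L[ℝ] ℝ) (m : ℝ)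
    {M : Matrix (Fin d) (Fin d) ℝ}
    (hM : ∀ i j, M i j = B (EuclideanSpace.single i 1) (EuclideanSpace.single j 1)
      - m * if i = j then 1 else 0)
    (a : EuclideanSpace ℝ (Fin d)) :
    a.ofLp ⬝ᵥ (M *ᵥ a.ofLp) = B a a - m * ‖a‖ ^ 2 := by
  have ha : a = ∑ i, a i • EuclideanSpace.single i (1 : ℝ) := by
    ext j
    simp [Finset.sum_apply, Pi.single_apply]
  have hB : B a a = ∑ i, ∑ j, a i * (a j *
      B (EuclideanSpace.single i 1) (EuclideanSpace.single j 1)) := by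
    conv_lhs => rw [ha]
    simp only [map_sum, map_smul, _root_.sum_apply, _root_.smul_apply, smul_eq_mul, Finset.mul_sum]
    rw [Finset.sum_comm]
    exact Finset.sum_congr rfl fun i _ => Finset.sum_congr rfl fun j _ => mul_left_comm _ _ _
  rw [hB, EuclideanSpace.real_norm_sq_eq, Finset.mul_sum, ← Finset.sum_sub_distrib]
  simp only [dotProduct, mulVec, Finset.mul_sum]
  refine Finset.sum_congr rfl fun i _ => ?_
  have : m * a i ^ 2 = ∑ j, a i * (m * (if i = j then 1 else 0) * a j) := by
    simp; ring
  rw [this, ← Finset.sum_sub_distrib]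
  refine Finset.sum_congr rfl fun j _ => ?_
  rw [hM]
  ring

/-- Conjugating by `I - vvᵀ` evaluates the quadratic form at the projected vector. -/
lemma dotProduct_conj_one_sub_vecMulVec {n : Type*} [Fintype n] [DecidableEq n]
    (M : Matrix n n ℝ) (v s : n → ℝ) :
    s ⬝ᵥ (((1 - vecMulVec v v) * M * (1 - vecMulVec v v)) *ᵥ s) =
      (s - (v ⬝ᵥ s) • v) ⬝ᵥ (M *ᵥ (s - (v ⬝ᵥ s) • v)) := by
  have h1 : (1 - vecMulVec v v) *ᵥ s = s - (v ⬝ᵥ s) • v := by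
    rw [sub_mulVec, one_mulVec, vecMulVec_mulVec]
    simp
  have h2 : s ᵥ* (1 - vecMulVec v v) = s - (v ⬝ᵥ s) • v := by
    rw [vecMul_sub, vecMul_one, vecMul_vecMulVec, dotProduct_comm]
  rw [← mulVec_mulVec, ← mulVec_mulVec, dotProduct_mulVec, h1, h2]

/-- second-order expansion of the contrast function `J` on the unit sphere around a
unit vector `v`, with linear term given by `φ(v)`, quadratic term given by `K(v)`, and a cubic
error bound. -/
theorem stmt6 {d : ℕ} {Ω : Type*} [MeasurableSpace Ω] (μ : Measure Ω) [IsProbabilityMeasure μ]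
    (x : Ω → EuclideanSpace ℝ (Fin d)) (G g g' : ℝ → ℝ)
    (hG : ∀ t : ℝ, HasDerivAt G (g t) t)
    (hg : ∀ t : ℝ, HasDerivAt g (g' t) t)
    (J : EuclideanSpace ℝ (Fin d) → ℝ)
    (hJdef : ∀ w, J w = ∫ ω, G ⟪w, x ω⟫ ∂μ)
    (v : EuclideanSpace ℝ (Fin d)) (hv : ‖v‖ = 1)
    (hJ : ContDiffAt ℝ 3 J v)
    (hgrad : HasGradientAt J (mvec μ x g v) v)
    (hhess : ∀ u w : EuclideanSpace ℝ (Fin d),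
      iteratedFDeriv ℝ 2 J v ![u, w] = ∫ ω, g' ⟪v, x ω⟫ * (⟪u, x ω⟫ * ⟪w, x ω⟫) ∂μ)
    (hInt1 : Integrable (fun ω => g ⟪v, x ω⟫ • x ω) μ)
    (hInt2 : Integrable (fun ω => g' ⟪v, x ω⟫) μ)
    (hInt3 : ∀ i j, Integrable (fun ω => g' ⟪v, x ω⟫ * (x ω i * x ω j)) μ) :
    ∃ C > (0 : ℝ), ∃ r > (0 : ℝ), ∀ w : EuclideanSpace ℝ (Fin d), ‖w‖ = 1 → ‖w - v‖ ≤ r →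
      |J w - J v - ⟪w - v, phifun μ x g v⟫
          - (1 / 2) * ⟪w - v, Matrix.toEuclideanLin (Kmat μ x g g' v) (w - v)⟫|
        ≤ C * ‖w - v‖ ^ 3 := by
  obtain ⟨C, hC, r, hr, htaylor⟩ := hJ.exists_abs_taylor_two_le
  set B := fderiv ℝ (fderiv ℝ J) v with hBdef
  set m : ℝ := ∫ ω, g' ⟪v, x ω⟫ ∂μ with hm
  set p : ℝ := ⟪v, mvec μ x g v⟫ with hp
  have hB : ∀ u w, B u w = ∫ ω, g' ⟪v, x ω⟫ * (⟪u, x ω⟫ * ⟪w, x ω⟫) ∂μ := fun u w => by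
    rw [← hhess u w, iteratedFDeriv_two_apply]
    rfl
  have hA : ∀ s, fderiv ℝ J v s = ⟪s, mvec μ x g v⟫ := fun s => by
    rw [hgrad.hasFDerivAt.fderiv, InnerProductSpace.toDual_apply_apply, real_inner_comm]
  have hα : alphafun μ x g g' v = m - p := by
    rw [alphafun, hp, mvec, ← integral_inner hInt1]
    simp only [real_inner_smul_right]
    rfl
  have hquad : ∀ s : EuclideanSpace ℝ (Fin d),
      ⟪s, Matrix.toEuclideanLin (Kmat μ x g g' v) s⟫ = (m - p) * ‖s‖ ^ 2
        + (B (s - ⟪v, s⟫ • v) (s - ⟪v, s⟫ • v) - m * ‖s - ⟪v, s⟫ • v‖ ^ 2) := fun s => by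
    rw [← dotProduct_mulVec_of_bilin_sub_smul B m
      (M := Matrix.of (fun i j => ∫ ω, g' ⟪v, x ω⟫ *
        (x ω i * x ω j - (if i = j then (1 : ℝ) else 0)) ∂μ)) ?_ (s - ⟪v, s⟫ • v)]
    · have hvs : ⟪v, s⟫ = v.ofLp ⬝ᵥ s.ofLp := by
        rw [EuclideanSpace.inner_eq_star_dotProduct, star_trivial, dotProduct_comm]
      have hss : ‖s‖ ^ 2 = s.ofLp ⬝ᵥ s.ofLp := by
        rw [EuclideanSpace.real_norm_sq_eq]
        simp [dotProduct, sq]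
      rw [EuclideanSpace.inner_eq_star_dotProduct, star_trivial, dotProduct_comm,
        Matrix.ofLp_toLpLin, Matrix.toLin'_apply, Kmat, add_mulVec, dotProduct_add, Lmat,
        dotProduct_conj_one_sub_vecMulVec, smul_mulVec, one_mulVec, dotProduct_smul, hα, hvs, hss]
      rfl
    · intro i j
      rw [Matrix.of_apply, hB]
      simp only [mul_sub, EuclideanSpace.inner_single_left, map_one, one_mul]
      rw [integral_sub (hInt3 i j) (hInt2.mul_const _), integral_mul_const]
  refine ⟨C + ‖B‖ + |m| + 1, by positivity, min (r / 2) 1, by positivity, fun w hw hwr => ?_⟩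
  have hwball : w ∈ Metric.ball v r := by
    rw [mem_ball_iff_norm]
    linarith [hwr.trans (min_le_left _ _)]
  have hw1 : ‖w - v‖ ≤ 1 := hwr.trans (min_le_right _ _)
  have hT := htaylor w hwball
  have hvs : ⟪v, w - v⟫ = -(‖w - v‖ ^ 2 / 2) := by
    rw [norm_sub_sq_real, inner_sub_right, real_inner_self_eq_norm_sq, real_inner_comm, hv, hw]
    ring
  rw [hA] at hT
  have hsymm : IsSymmSndFDerivAt ℝ J v := hJ.isSymmSndFDerivAt (by simp; norm_num)
  set s := w - v with hs
  have hnorm : ‖s - ⟪v, s⟫ • v‖ ^ 2 = ‖s‖ ^ 2 - ‖s‖ ^ 4 / 4 := by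
    rw [norm_sub_sq_real, real_inner_smul_right, norm_smul, hv, real_inner_comm v s, hvs, mul_one,
      Real.norm_eq_abs, sq_abs]
    ring
  have hBp : B (s - ⟪v, s⟫ • v) (s - ⟪v, s⟫ • v)
      = B s s + ‖s‖ ^ 2 * B s v + ‖s‖ ^ 4 / 4 * B v v := by
    have := hsymm v s
    rw [← hBdef] at this
    simp only [map_sub, map_smul, _root_.sub_apply, _root_.smul_apply, smul_eq_mul, this, hvs]
    ring
  have hphi : ⟪s, phifun μ x g v⟫ = ⟪s, mvec μ x g v⟫ + p * ‖s‖ ^ 2 / 2 := by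
    rw [phifun, inner_sub_right, real_inner_smul_right, real_inner_comm v s, hvs]
    ring
  have hBsv : |B s v| ≤ ‖B‖ * ‖s‖ := by
    simpa [hv] using B.le_opNorm₂ s v
  have hBvv : |B v v| ≤ ‖B‖ := by
    simpa [hv] using B.le_opNorm₂ v v
  have h43 : ‖s‖ ^ 4 ≤ ‖s‖ ^ 3 := pow_le_pow_of_le_one (norm_nonneg _) hw1 (by norm_num)
  have e1 : |‖s‖ ^ 2 * B s v| ≤ ‖B‖ * ‖s‖ ^ 3 := by
    rw [abs_mul, abs_of_nonneg (by positivity : 0 ≤ ‖s‖ ^ 2)]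
    calc ‖s‖ ^ 2 * |B s v| ≤ ‖s‖ ^ 2 * (‖B‖ * ‖s‖) := by gcongr
      _ = ‖B‖ * ‖s‖ ^ 3 := by ring
  have e2 : |‖s‖ ^ 4 * B v v| ≤ ‖B‖ * ‖s‖ ^ 3 := by
    rw [abs_mul, abs_of_nonneg (by positivity : 0 ≤ ‖s‖ ^ 4), mul_comm]
    gcongr
  have e3 : |‖s‖ ^ 4 * m| ≤ |m| * ‖s‖ ^ 3 := by
    rw [abs_mul, abs_of_nonneg (by positivity : 0 ≤ ‖s‖ ^ 4), mul_comm]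
    gcongr
  have h3 : 0 ≤ ‖s‖ ^ 3 := by positivity
  have hB3 : 0 ≤ ‖B‖ * ‖s‖ ^ 3 := by positivity
  have hm3 : 0 ≤ |m| * ‖s‖ ^ 3 := by positivity
  rw [hquad, hBp, hnorm, hphi]
  rw [abs_le] at hT e1 e2 e3 ⊢
  constructor <;> linarith [hT.1, hT.2, e1.1, e1.2, e2.1, e2.2, e3.1, e3.2]
end
end

section
/- Let f : ℝ^d → ℝ^d be differentiable on an open convex set U, let v ∈ U with f(v) = v, and let w₀ ∈ U with ‖w₀‖ = 1 and ‖f(w₀)‖ = 1. Set K := sup over ξ on the segment [v, w₀] of the operator norm ‖Df(ξ)‖ (assumed finite). Then 1 − |w₀ᵀ f(w₀)| ≤ ½·(1 + K)²·‖w₀ − v‖². (Hence if w₀ lies within distance √(2ε)/(1+K) of a fixed point v, the FastICA stopping criterion 1 − |w_newᵀ w_old| < ε is triggered after a single iteration.) -/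
open scoped RealInnerProductSpace

noncomputable section

/-- false-convergence bound for the FastICA stopping criterion: if `f(v) = v` and
`K` is the supremum of `‖Df‖` over the segment `[v, w₀]`, then
`1 − |w₀ᵀ f(w₀)| ≤ ½(1 + K)²‖w₀ − v‖²`. -/
theorem stmt17 {d : ℕ} (f : EuclideanSpace ℝ (Fin d) → EuclideanSpace ℝ (Fin d))
    (U : Set (EuclideanSpace ℝ (Fin d))) (hUopen : IsOpen U) (hUconv : Convex ℝ U)
    (hdiff : DifferentiableOn ℝ f U)
    (v : EuclideanSpace ℝ (Fin d)) (hv : v ∈ U) (hfv : f v = v)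
    (w₀ : EuclideanSpace ℝ (Fin d)) (hw₀ : w₀ ∈ U)
    (hnw : ‖w₀‖ = 1) (hnfw : ‖f w₀‖ = 1)
    (hbdd : BddAbove ((fun ξ => ‖fderiv ℝ f ξ‖) '' segment ℝ v w₀)) :
    1 - |⟪w₀, f w₀⟫| ≤
      (1 / 2) * (1 + sSup ((fun ξ => ‖fderiv ℝ f ξ‖) '' segment ℝ v w₀)) ^ 2
        * ‖w₀ - v‖ ^ 2 := by
  set K := sSup ((fun ξ => ‖fderiv ℝ f ξ‖) '' segment ℝ v w₀)
  have hseg : segment ℝ v w₀ ⊆ U := hUconv.segment_subset hv hw₀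
  have hlip : ‖f w₀ - f v‖ ≤ K * ‖w₀ - v‖ :=
    (convex_segment v w₀).norm_image_sub_le_of_norm_fderiv_le
      (fun ξ hξ => hdiff.differentiableAt (hUopen.mem_nhds (hseg hξ)))
      (fun ξ hξ => le_csSup hbdd ⟨ξ, hξ, rfl⟩)
      (left_mem_segment ℝ v w₀) (right_mem_segment ℝ v w₀)
  have hdist : ‖w₀ - f w₀‖ ≤ (1 + K) * ‖w₀ - v‖ :=
    calc ‖w₀ - f w₀‖ = ‖(w₀ - v) - (f w₀ - f v)‖ := by rw [hfv, sub_sub_sub_cancel_right]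
      _ ≤ ‖w₀ - v‖ + ‖f w₀ - f v‖ := norm_sub_le _ _
      _ ≤ (1 + K) * ‖w₀ - v‖ := by linarith
  have hinner : ‖w₀ - f w₀‖ ^ 2 = 2 - 2 * ⟪w₀, f w₀⟫ := by
    rw [norm_sub_sq_real, hnw, hnfw]
    ring
  have hsq : ‖w₀ - f w₀‖ ^ 2 ≤ ((1 + K) * ‖w₀ - v‖) ^ 2 := by gcongr
  rw [mul_pow] at hsq
  linarith [le_abs_self ⟪w₀, f w₀⟫]
end
end
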